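/- Let n = (V, {·,·}) be a finite-dimensional Lie algebra over a field K of characteristic zero, R a Rota–Baxter operator of weight 1 on n, and let g = (V, [·,·]) be the Lie algebra with the induced bracket [x,y] = {R(x), y} − {R(y), x} + {x, y}. Then: (1) if g and n are not isomorphic as Lie algebras, then both ker(R) and ker(R + id) are nonzero; (2) if g or n is not solvable, then at least one of ker(R) and ker(R + id) is nonzero. -/

import Mathlib

/-- A Lie bracket on the `K`-vector space `V`, given as a plain binary product:
it is `K`-bilinear, alternating, and satisfies the Jacobi identity
(in Leibniz form). -/
def IsLieBr (K : Type*) {V : Type*} [Field K] [CharZero K] [AddCommGroup V] [Module K V]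
    (b : V → V → V) : Prop :=
  (∀ x : V, IsLinearMap K (b x)) ∧ (∀ y : V, IsLinearMap K fun x => b x y) ∧
  (∀ x : V, b x x = 0) ∧ ∀ x y z : V, b x (b y z) = b (b x y) z + b y (b x z)

/-- A Rota–Baxter operator of weight `lam` on the Lie algebra `(V, b)`. -/
def IsLieRB (K : Type*) {V : Type*} [Field K] [CharZero K] [AddCommGroup V] [Module K V]
    (b : V → V → V) (R : V →ₗ[K] V) (lam : K) : Prop :=
  ∀ x y : V, b (R x) (R y) = R (b (R x) y + b x (R y) + lam • b x y)

/-- The bracket `[x,y] = {R x, y} - {R y, x} + {x, y}` induced by an operator `R`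
on a Lie algebra `(V, b)`. -/
def indBr {K V : Type*} [Field K] [CharZero K] [AddCommGroup V] [Module K V]
    (b : V → V → V) (R : V →ₗ[K] V) : V → V → V :=
  fun x y => b (R x) y - b (R y) x + b x y

/-- A post-Lie algebra structure on the pair of Lie algebras `(V, gb)` and `(V, nb)`:
a bilinear product `mul` with `x·y - y·x = [x,y] - {x,y}`, `[x,y]·z = x·(y·z) - y·(x·z)`
and `x·{y,z} = {x·y, z} + {y, x·z}`. -/
def IsPostLie (K : Type*) {V : Type*} [Field K] [CharZero K] [AddCommGroup V] [Module K V]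
    (gb nb mul : V → V → V) : Prop :=
  (∀ x : V, IsLinearMap K (mul x)) ∧ (∀ y : V, IsLinearMap K fun x => mul x y) ∧
  (∀ x y : V, mul x y - mul y x = gb x y - nb x y) ∧
  (∀ x y z : V, mul (gb x y) z = mul x (mul y z) - mul y (mul x z)) ∧
  (∀ x y z : V, mul x (nb y z) = nb (mul x y) z + nb y (mul x z))

/-- The derived series of the Lie algebra `(V, b)`. -/
def derSeries (K : Type*) {V : Type*} [Field K] [CharZero K] [AddCommGroup V] [Module K V]
    (b : V → V → V) : ℕ → Submodule K V
  | 0 => ⊤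
  | n + 1 => Submodule.span K
      {z | ∃ x ∈ derSeries K b n, ∃ y ∈ derSeries K b n, z = b x y}

/-- The Lie algebra `(V, b)` is solvable. -/
def IsSolvableBr (K : Type*) {V : Type*} [Field K] [CharZero K] [AddCommGroup V] [Module K V]
    (b : V → V → V) : Prop :=
  ∃ n : ℕ, derSeries K b n = ⊥

/-- An isomorphism of the Lie algebras `(V, b)` and `(W, b')`. -/
def LieBrIso (K : Type*) {V W : Type*} [Field K] [CharZero K] [AddCommGroup V] [Module K V]
    [AddCommGroup W] [Module K W] (b : V → V → V) (b' : W → W → W) : Prop :=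
  ∃ e : V ≃ₗ[K] W, ∀ x y : V, e (b x y) = b' (e x) (e y)

theorem isJacobsonRing_int : IsJacobsonRing ℤ := by
  rw [isJacobsonRing_iff_prime_eq]
  intro P hP
  by_cases h : P = ⊥
  · subst h
    rw [eq_bot_iff]
    intro x hx
    have := Int.isUnit_iff.1 (Ideal.mem_jacobson_bot.1 hx x)
    rw [Ideal.mem_bot]
    rcases this with h | h <;> nlinarith
  · have := hP.isMaximal h
    exact Ideal.jacobson_eq_self_of_isMaximal

theorem finite_of_field_of_finite_int (F : Type*) [Field F] [Module.Finite ℤ F] : Finite F := by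
  have hni : ¬ Function.Injective (algebraMap ℤ F) := fun hi =>
    Int.not_isField (isField_of_isIntegral_of_isField hi (Field.toIsField F))
  rw [injective_iff_map_eq_zero] at hni
  push Not at hni
  obtain ⟨p, hp, hp0⟩ := hni
  refine Module.finite_of_fg_torsion F fun x => ⟨⟨p, mem_nonZeroDivisors_of_ne_zero hp0⟩, ?_⟩
  change p • x = 0
  rw [Algebra.smul_def, hp, zero_mul]

/-- Finitely many elements of a field other than `0` and `1` admit a logarithm to a finite cyclic
group that vanishes on none of them: reduce modulo a maximal ideal of a finitely generated ring. -/
theorem exists_zmod_log {K : Type*} [Field K] (S : Finset K) (h0 : (0 : K) ∉ S) (h1 : (1 : K) ∉ S) :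
    ∃ (n : ℕ) (_ : NeZero n) (f : K → ZMod n), (∀ s ∈ S, f s ≠ 0) ∧
      ∀ s ∈ S, ∀ t ∈ S, s * t ∈ S → f (s * t) = f s + f t := by
  classical
  let A : Subalgebra ℤ K :=
    Algebra.adjoin ℤ (S ∪ S.image (fun s => s⁻¹) ∪ S.image (fun s => (s - 1)⁻¹) : Finset K)
  have : Algebra.FiniteType ℤ A := by
    rw [← Subalgebra.fg_iff_finiteType]; exact ⟨_, rfl⟩
  have hsub : ∀ s ∈ S, s ∈ A ∧ s⁻¹ ∈ A ∧ (s - 1)⁻¹ ∈ A := fun s hs =>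
    ⟨Algebra.subset_adjoin (by simp [hs]), Algebra.subset_adjoin (by simp [hs]),
      Algebra.subset_adjoin (by
        push_cast; exact Or.inr ⟨s, hs, rfl⟩)⟩
  obtain ⟨m, hm⟩ := Ideal.exists_maximal A
  let _ : Field (A ⧸ m) := Ideal.Quotient.field m
  have := isJacobsonRing_int
  have : Module.Finite ℤ (A ⧸ m) := finite_of_finite_type_of_isJacobsonRing ℤ (A ⧸ m)
  have : Finite (A ⧸ m) := finite_of_field_of_finite_int _
  let q := Ideal.Quotient.mk m
  have hq : ∀ s (hs : s ∈ S), q ⟨s, (hsub s hs).1⟩ ≠ 0 ∧ q ⟨s, (hsub s hs).1⟩ ≠ 1 := by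
    intro s hs
    have hs0 : s ≠ 0 := fun h => h0 (h ▸ hs)
    have hs1 : s - 1 ≠ 0 := fun h => h1 (sub_eq_zero.1 h ▸ hs)
    constructor
    · refine left_ne_zero_of_mul_eq_one (b := q ⟨_, (hsub s hs).2.1⟩) ?_
      rw [← map_mul, ← map_one q]
      exact congrArg q (Subtype.ext (mul_inv_cancel₀ hs0))
    · rw [← sub_ne_zero, ← map_one q, ← map_sub]
      refine left_ne_zero_of_mul_eq_one (b := q ⟨_, (hsub s hs).2.2⟩) ?_
      rw [← map_mul, ← map_one q]
      exact congrArg q (Subtype.ext (mul_inv_cancel₀ hs1))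
  let e : Multiplicative (ZMod (Nat.card (A ⧸ m)ˣ)) ≃* (A ⧸ m)ˣ := zmodCyclicMulEquiv inferInstance
  refine ⟨Nat.card (A ⧸ m)ˣ, ⟨Nat.card_pos.ne'⟩,
    fun s => if hs : s ∈ S then (e.symm (Units.mk0 _ (hq s hs).1)).toAdd else 0, ?_, ?_⟩
  · intro s hs h
    simp only [dif_pos hs] at h
    rw [toAdd_eq_zero, map_eq_one_iff _ e.symm.injective, Units.ext_iff] at h
    exact (hq s hs).2 h
  · intro s hs t ht hst
    simp only [dif_pos hs, dif_pos ht, dif_pos hst]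
    rw [← toAdd_mul, ← map_mul]
    congr 2
    ext
    exact map_mul q (⟨s, (hsub s hs).1⟩ : A) ⟨t, (hsub t ht).1⟩

/-- A perfect Lie algebra with a grading whose support is detected by nonzero elements of a finite
cyclic group is trivial (Kreknin's argument). -/
theorem subsingleton_of_graded_perfect {K L ι : Type*} [Field K] [LieRing L] [LieAlgebra K L]
    [Mul ι] (G : ι → Submodule K L)
    (hG : ∀ a b, ∀ x ∈ G a, ∀ y ∈ G b, ⁅x, y⁆ ∈ G (a * b))
    (hind : iSupIndep G) (htop : ⨆ a, G a = ⊤) (n : ℕ) [NeZero n] (f : ι → ZMod n)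
    (hf : ∀ a, G a ≠ ⊥ → f a ≠ 0)
    (hmul : ∀ a b, G a ≠ ⊥ → G b ≠ ⊥ → G (a * b) ≠ ⊥ → f (a * b) = f a + f b)
    (hperf : Submodule.span K {z : L | ∃ x y : L, ⁅x, y⁆ = z} = ⊤) : Subsingleton L := by
  let S : ℕ → Set L := fun k => {x | ∃ a, G a ≠ ⊥ ∧ k ≤ (f a).val ∧ x ∈ G a}
  have key : ∀ k, LieSubalgebra.lieSpan K L (S k) = ⊤ := by
    intro k
    induction k with
    | zero =>
      rw [eq_top_iff, ← LieSubalgebra.toSubmodule_le_toSubmodule, LieSubalgebra.top_toSubmodule,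
        ← htop]
      refine iSup_le fun a x hx => ?_
      by_cases ha : G a = ⊥
      · rw [ha, Submodule.mem_bot] at hx
        rw [hx]; exact zero_mem _
      · exact LieSubalgebra.subset_lieSpan ⟨a, ha, Nat.zero_le _, hx⟩
    | succ k ih =>
      let T : Submodule K L := Submodule.span K
        {z | ∃ c a, G c ≠ ⊥ ∧ G a ≠ ⊥ ∧ k ≤ (f a).val ∧ ∃ x ∈ G c, ∃ y ∈ G a, z = ⁅x, y⁆}
      have hT : ∀ u y : L, ⁅y, u⁆ ∈ T := by
        intro u
        have hu : u ∈ LieSubalgebra.lieSpan K L (S k) := by rw [ih]; trivial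
        induction hu using LieSubalgebra.lieSpan_induction with
        | mem u hu =>
          obtain ⟨a, ha, hk, hua⟩ := hu
          intro y
          have hy : y ∈ ⨆ c, G c := by rw [htop]; trivial
          induction hy using Submodule.iSup_induction' with
          | mem c y hy =>
            by_cases hc : G c = ⊥
            · rw [hc, Submodule.mem_bot] at hy
              rw [hy, zero_lie]; exact zero_mem _
            · exact Submodule.subset_span ⟨c, a, hc, ha, hk, y, hy, u, hua, rfl⟩
          | zero => rw [zero_lie]; exact zero_mem _
          | add y z _ _ hy hz => rw [add_lie]; exact add_mem hy hz
        | zero => intro y; rw [lie_zero]; exact zero_mem _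
        | smul r u _ h => intro y; rw [lie_smul]; exact T.smul_mem r (h y)
        | add u v _ _ h h' => intro y; rw [lie_add]; exact add_mem (h y) (h' y)
        | lie u v _ _ h h' =>
          intro y
          rw [leibniz_lie, ← lie_skew u]
          exact add_mem (h' _) (neg_mem (h _))
      have hTtop : T = ⊤ := by
        rw [eq_top_iff, ← hperf, Submodule.span_le]
        rintro _ ⟨x, y, rfl⟩
        exact hT y x
      rw [eq_top_iff, ← ih, LieSubalgebra.lieSpan_le]
      rintro x ⟨a, ha, hk, hx⟩
      rcases Nat.lt_or_ge k (f a).val with hlt | hge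
      · exact LieSubalgebra.subset_lieSpan ⟨a, ha, hlt, hx⟩
      have hka : (f a).val = k := le_antisymm hge hk
      let M : Submodule K L := (LieSubalgebra.lieSpan K L (S (k + 1))).toSubmodule ⊓ G a
      let P : Submodule K L := ⨆ b, ⨆ (_ : b ≠ a), G b
      have hTle : T ≤ M ⊔ P := by
        rw [Submodule.span_le]
        rintro _ ⟨c, d, hc, hd, hkd, y, hy, z, hz, rfl⟩
        have hyz := hG c d y hy z hz
        by_cases hcd : c * d = a
        · refine Submodule.mem_sup_left ⟨?_, hcd ▸ hyz⟩
          have hsum := hmul c d hc hd (hcd ▸ ha)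
          rw [hcd] at hsum
          have hv : (f a).val = ((f c).val + (f d).val) % n := by rw [hsum, ZMod.val_add]
          have hc0 : (f c).val ≠ 0 := (ZMod.val_ne_zero _).2 (hf c hc)
          have hcn := ZMod.val_lt (f c)
          have hdn := ZMod.val_lt (f d)
          have h2 : k < (f c).val ∧ k < (f d).val := by
            rw [hka] at hv
            rcases Nat.lt_or_ge ((f c).val + (f d).val) n with h | h
            · rw [Nat.mod_eq_of_lt h] at hv; omega
            · rw [Nat.mod_eq_sub_mod h, Nat.mod_eq_of_lt (by omega)] at hv; omega
          exact LieSubalgebra.lie_mem _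
            (LieSubalgebra.subset_lieSpan ⟨c, hc, h2.1, hy⟩)
            (LieSubalgebra.subset_lieSpan ⟨d, hd, h2.2, hz⟩)
        · exact Submodule.mem_sup_right
            (Submodule.mem_iSup_of_mem (c * d) (Submodule.mem_iSup_of_mem hcd hyz))
      have hle : G a ≤ M := by
        have h1 : (M ⊔ P) ⊓ G a = M := by
          rw [sup_inf_assoc_of_le P (inf_le_right : M ≤ G a), inf_comm P,
            (hind a).eq_bot, sup_bot_eq]
        have h2 : M ⊔ P = ⊤ := top_le_iff.1 (by rwa [hTtop] at hTle)
        rw [← h1, h2, top_inf_eq]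
      exact (hle hx).1
  have hn := key n
  have hS : S n = ∅ := by
    ext x
    simp only [S, Set.mem_ofPred_eq, Set.mem_empty_iff_false, iff_false]
    rintro ⟨a, -, h, -⟩
    exact absurd (ZMod.val_lt (f a)) (by omega)
  rw [hS, LieSubalgebra.span_empty] at hn
  refine ⟨fun x y => ?_⟩
  have h0 : ∀ x : L, x = 0 := fun x => by
    have : x ∈ (⊤ : LieSubalgebra K L) := trivial
    rwa [← hn, LieSubalgebra.mem_bot] at this
  rw [h0 x, h0 y]

/-- The generalized eigenspaces of a Lie algebra endomorphism form a multiplicative grading. -/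
theorem lie_mem_maxGenEigenspace_of_map_lie {K L : Type*} [Field K] [LieRing L] [LieAlgebra K L]
    (φ : Module.End K L) (hφ : ∀ x y, φ ⁅x, y⁆ = ⁅φ x, φ y⁆) (a b : K) (x : L)
    (hx : x ∈ φ.maxGenEigenspace a) (y : L) (hy : y ∈ φ.maxGenEigenspace b) :
    ⁅x, y⁆ ∈ φ.maxGenEigenspace (a * b) := by
  have hstep : ∀ x y : L, (φ - (a * b) • (1 : Module.End K L)) ⁅x, y⁆ =
      ⁅(φ - a • (1 : Module.End K L)) x, φ y⁆ + a • ⁅x, (φ - b • (1 : Module.End K L)) y⁆ := by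
    intro x y
    simp only [LinearMap.sub_apply, LinearMap.smul_apply, Module.End.one_apply, hφ, sub_lie,
      lie_sub, smul_lie, lie_smul, smul_sub, mul_smul]
    abel
  have hcomm : ∀ (q : ℕ) (y : L), ((φ - b • (1 : Module.End K L)) ^ q) y = 0 →
      ((φ - b • (1 : Module.End K L)) ^ q) (φ y) = 0 := by
    intro q y h
    have hc : Commute ((φ - b • (1 : Module.End K L)) ^ q) φ :=
      (((Commute.refl φ).sub_left ((Commute.one_left φ).smul_left b))).pow_left q
    rw [← Module.End.mul_apply, hc.eq, Module.End.mul_apply, h, map_zero]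
  have main : ∀ (m p q : ℕ), p + q = m → ∀ x y : L,
      ((φ - a • (1 : Module.End K L)) ^ p) x = 0 → ((φ - b • (1 : Module.End K L)) ^ q) y = 0 →
      ((φ - (a * b) • (1 : Module.End K L)) ^ m) ⁅x, y⁆ = 0 := by
    intro m
    induction m with
    | zero =>
      intro p q h x y hx _
      obtain rfl : p = 0 := by omega
      rw [pow_zero, Module.End.one_apply] at hx
      rw [hx, zero_lie, map_zero]
    | succ m ih =>
      intro p q h x y hx hy
      rcases p with _ | p
      · rw [pow_zero, Module.End.one_apply] at hx
        rw [hx, zero_lie, map_zero]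
      rcases q with _ | q
      · rw [pow_zero, Module.End.one_apply] at hy
        rw [hy, lie_zero, map_zero]
      rw [pow_succ, Module.End.mul_apply, hstep, map_add, map_smul,
        ih p (q + 1) (by omega) _ _ (by rwa [pow_succ, Module.End.mul_apply] at hx) (hcomm _ _ hy),
        ih (p + 1) q (by omega) _ _ hx (by rwa [pow_succ, Module.End.mul_apply] at hy),
        smul_zero, add_zero]
  rw [Module.End.mem_maxGenEigenspace] at hx hy ⊢
  obtain ⟨p, hp⟩ := hx
  obtain ⟨q, hq⟩ := hy
  exact ⟨p + q, main _ p q rfl x y hp hq⟩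

theorem maxGenEigenspace_eq_bot_of_injective {K M : Type*} [Field K] [AddCommGroup M] [Module K M]
    (φ : Module.End K M) (a : K)
    (h : Function.Injective (φ - a • (1 : Module.End K M))) : φ.maxGenEigenspace a = ⊥ := by
  rw [eq_bot_iff]
  intro x hx
  obtain ⟨k, hk⟩ := (Module.End.mem_maxGenEigenspace φ a x).1 hx
  have hinj : Function.Injective ((φ - a • (1 : Module.End K M)) ^ k) := by
    rw [Module.End.coe_pow]; exact h.iterate k
  exact hinj (hk.trans (map_zero _).symm)

theorem isSolvable_of_fixedPointFree_of_isAlgClosed {K : Type*} [Field K] [IsAlgClosed K] (d : ℕ)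
    {L : Type*} [LieRing L] [LieAlgebra K L] [FiniteDimensional K L]
    (hd : Module.finrank K L = d)
    (φ : Module.End K L) (hφ : ∀ x y, φ ⁅x, y⁆ = ⁅φ x, φ y⁆)
    (hinj : Function.Injective φ) (hfix : Function.Injective (φ - (1 : Module.End K L))) :
    LieAlgebra.IsSolvable L := by
  induction d using Nat.strong_induction_on generalizing L with
  | _ d ih =>
    by_cases hperf : LieAlgebra.derivedSeries K L 1 = ⊤
    · classical
      have hfin : {a | φ.maxGenEigenspace a ≠ ⊥}.Finite :=
        WellFoundedGT.finite_ne_bot_of_iSupIndep φ.independent_maxGenEigenspace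
      have hmem : ∀ a, a ∈ hfin.toFinset ↔ φ.maxGenEigenspace a ≠ ⊥ := fun a => by simp
      obtain ⟨n, hn, f, hf, hmul⟩ := exists_zmod_log hfin.toFinset
        (by rw [hmem, not_not]
            exact maxGenEigenspace_eq_bot_of_injective φ 0 (by rwa [zero_smul, sub_zero]))
        (by rw [hmem, not_not]
            exact maxGenEigenspace_eq_bot_of_injective φ 1 (by rwa [one_smul]))
      simp only [hmem] at hf hmul
      have : Subsingleton L := subsingleton_of_graded_perfect (fun a => φ.maxGenEigenspace a)
        (lie_mem_maxGenEigenspace_of_map_lie φ hφ) φ.independent_maxGenEigenspace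
        (Module.End.iSup_maxGenEigenspace_eq_top φ) n f hf (fun a b ha hb => hmul a ha b hb)
        (by rw [← LieAlgebra.coe_derivedSeries_one_eq, hperf]; rfl)
      exact LieAlgebra.IsSolvable.mk (R := K) (k := 0) (Subsingleton.elim _ _)
    · set D := LieAlgebra.derivedSeries K L 1
      have hmap : ∀ x ∈ D.toSubmodule, φ x ∈ D.toSubmodule := by
        change D.toSubmodule ≤ D.toSubmodule.comap φ
        have hspan : D.toSubmodule = Submodule.span K {⁅x, y⁆ | (x : L) (y : L)} :=
          LieAlgebra.coe_derivedSeries_one_eq K L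
        rw [hspan, Submodule.span_le]
        rintro _ ⟨x, y, rfl⟩
        exact Submodule.subset_span ⟨φ x, φ y, (hφ x y).symm⟩
      have hlt : Module.finrank K D < d := by
        rw [← hd]
        exact Submodule.finrank_lt (s := D.toSubmodule) (by simpa using hperf)
      have hs : LieAlgebra.IsSolvable D := by
        refine ih _ hlt rfl (φ.restrict hmap) (fun x y => Subtype.ext (hφ x y)) ?_ ?_
        · intro x y h
          exact Subtype.ext (hinj (congrArg Subtype.val h))
        · intro x y h
          exact Subtype.ext (hfix (congrArg Subtype.val h))
      obtain ⟨k, hk⟩ := (LieAlgebra.isSolvable_iff K (L := D)).1 hs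
      rw [LieIdeal.derivedSeries_eq_bot_iff] at hk
      refine LieAlgebra.IsSolvable.mk (R := K) (k := k + 1) ?_
      rw [LieAlgebra.derivedSeries_def, LieAlgebra.derivedSeriesOfIdeal_add]
      exact hk

open TensorProduct in
/-- A finite-dimensional Lie algebra with a fixed-point-free automorphism is solvable. -/
theorem isSolvable_of_fixedPointFree {K L : Type*} [Field K] [LieRing L] [LieAlgebra K L]
    [FiniteDimensional K L] (φ : Module.End K L) (hφ : ∀ x y, φ ⁅x, y⁆ = ⁅φ x, φ y⁆)
    (hinj : Function.Injective φ) (hfix : Function.Injective (φ - (1 : Module.End K L))) :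
    LieAlgebra.IsSolvable L := by
  rw [← LieAlgebra.isSolvable_tensorProduct_iff (R := K) (L := L) (A := AlgebraicClosure K)]
  refine isSolvable_of_fixedPointFree_of_isAlgClosed (K := AlgebraicClosure K) _ rfl
    (φ.baseChange (AlgebraicClosure K)) ?_ ?_ ?_
  · intro x y
    induction x using TensorProduct.induction_on with
    | zero => simp only [zero_lie, map_zero]
    | add x x' h h' => simp only [add_lie, map_add, h, h']
    | tmul s x =>
      induction y using TensorProduct.induction_on with
      | zero => simp only [lie_zero, map_zero]
      | add x x' h h' => simp only [lie_add, map_add, h, h']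
      | tmul t y =>
        simp only [LieAlgebra.ExtendScalars.bracket_tmul, LinearMap.baseChange_tmul, hφ]
  · exact Module.Flat.lTensor_preserves_injective_linearMap φ hinj
  · have h := Module.Flat.lTensor_preserves_injective_linearMap (M := AlgebraicClosure K) _ hfix
    have he : φ.baseChange (AlgebraicClosure K) - 1 = (φ - (1 : Module.End K L)).baseChange (AlgebraicClosure K) := by
      rw [LinearMap.baseChange_sub, LinearMap.baseChange_one]
    rw [he]
    exact h

/-- The Lie ring structure on `V` given by a bracket satisfying `IsLieBr`. -/
abbrev IsLieBr.lieRing {K V : Type*} [Field K] [CharZero K] [AddCommGroup V] [Module K V]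
    {b : V → V → V} (h : IsLieBr K b) : LieRing V where
  bracket := b
  add_lie x y z := (h.2.1 z).map_add x y
  lie_add x y z := (h.1 x).map_add y z
  lie_self := h.2.2.1
  leibniz_lie := h.2.2.2

/-- The Lie algebra structure on `V` given by a bracket satisfying `IsLieBr`. -/
abbrev IsLieBr.lieAlgebra {K V : Type*} [Field K] [CharZero K] [AddCommGroup V] [Module K V]
    {b : V → V → V} (h : IsLieBr K b) : @LieAlgebra K V _ h.lieRing :=
  letI := h.lieRing
  { (inferInstance : Module K V) with
    lie_smul := fun t x y => (h.1 x).map_smul t y }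

theorem IsLieBr.isSolvableBr {K V : Type*} [Field K] [CharZero K] [AddCommGroup V] [Module K V]
    {b : V → V → V} (h : IsLieBr K b) (hs : @LieAlgebra.IsSolvable V h.lieRing) :
    IsSolvableBr K b := by
  let _ := h.lieRing
  let _ := h.lieAlgebra
  have key : ∀ n, derSeries K b n = (LieAlgebra.derivedSeries K V n).toSubmodule := by
    intro n
    induction n with
    | zero => rfl
    | succ n ih =>
      rw [LieAlgebra.derivedSeries_def, LieAlgebra.derivedSeriesOfIdeal_succ,
        LieSubmodule.lieIdeal_oper_eq_linear_span', derSeries, ih]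
      congr 1
      ext z
      constructor
      · rintro ⟨x, hx, y, hy, rfl⟩
        exact ⟨x, hx, y, hy, rfl⟩
      · rintro ⟨x, hx, y, hy, rfl⟩
        exact ⟨x, hx, y, hy, rfl⟩
  obtain ⟨n, hn⟩ := (LieAlgebra.isSolvable_iff K (L := V)).1 hs
  exact ⟨n, by rw [key, hn]; rfl⟩

theorem IsSolvableBr.of_injective {K V W : Type*} [Field K] [CharZero K] [AddCommGroup V]
    [Module K V] [AddCommGroup W] [Module K W] {b : V → V → V} {b' : W → W → W}
    (f : V →ₗ[K] W) (hf : ∀ x y, f (b x y) = b' (f x) (f y)) (hinj : Function.Injective f)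
    (hs : IsSolvableBr K b') : IsSolvableBr K b := by
  have key : ∀ n, derSeries K b n ≤ (derSeries K b' n).comap f := by
    intro n
    induction n with
    | zero => exact fun _ _ => trivial
    | succ n ih =>
      refine Submodule.span_le.2 ?_
      rintro _ ⟨x, hx, y, hy, rfl⟩
      exact Submodule.subset_span ⟨f x, ih hx, f y, ih hy, hf x y⟩
  obtain ⟨n, hn⟩ := hs
  refine ⟨n, eq_bot_iff.2 fun x hx => ?_⟩
  have := key n hx
  rw [hn] at this
  exact hinj (((Submodule.mem_bot K).1 this).trans (map_zero f).symm)

theorem IsLieRB.map_indBr {K V : Type*} [Field K] [CharZero K] [AddCommGroup V] [Module K V]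
    {b : V → V → V} (h : IsLieBr K b) {R : V →ₗ[K] V} (hR : IsLieRB K b R 1) (x y : V) :
    R (indBr b R x y) = b (R x) (R y) := by
  let _ := h.lieRing
  have hskew : b x (R y) = -b (R y) x := (lie_skew x (R y)).symm
  rw [hR x y, indBr, one_smul, hskew, sub_eq_add_neg]

theorem IsLieRB.add_id_map_indBr {K V : Type*} [Field K] [CharZero K] [AddCommGroup V]
    [Module K V] {b : V → V → V} (h : IsLieBr K b) {R : V →ₗ[K] V} (hR : IsLieRB K b R 1)
    (x y : V) :
    (R + LinearMap.id : V →ₗ[K] V) (indBr b R x y) =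
      b ((R + LinearMap.id : V →ₗ[K] V) x) ((R + LinearMap.id : V →ₗ[K] V) y) := by
  let _ := h.lieRing
  have hskew : b x (R y) = -b (R y) x := (lie_skew x (R y)).symm
  rw [LinearMap.add_apply, hR.map_indBr h]
  simp only [LinearMap.add_apply, LinearMap.id_apply, (h.1 _).map_add,
    (h.2.1 _).map_add, hskew, indBr]
  abel

theorem lieBrIso_of_ker_eq_bot {K V : Type*} [Field K] [CharZero K] [AddCommGroup V] [Module K V]
    [FiniteDimensional K V] {b b' : V → V → V} (f : V →ₗ[K] V) (hf : LinearMap.ker f = ⊥)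
    (hb : ∀ x y, f (b x y) = b' (f x) (f y)) : LieBrIso K b b' :=
  ⟨LinearEquiv.ofInjectiveEndo f (LinearMap.ker_eq_bot.1 hf), hb⟩

theorem IsLieRB.isSolvableBr {K V : Type*} [Field K] [CharZero K] [AddCommGroup V] [Module K V]
    [FiniteDimensional K V] {b : V → V → V} (h : IsLieBr K b) {R : V →ₗ[K] V}
    (hR : IsLieRB K b R 1) (hker : LinearMap.ker R = ⊥)
    (hker' : LinearMap.ker (R + LinearMap.id) = ⊥) : IsSolvableBr K b := by
  refine h.isSolvableBr ?_
  let _ := h.lieRing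
  let _ := h.lieAlgebra
  let e : V ≃ₗ[K] V := LinearEquiv.ofInjectiveEndo R (LinearMap.ker_eq_bot.1 hker)
  have he : ∀ x, e x = R x := fun _ => rfl
  let φ : Module.End K V := (R + LinearMap.id) ∘ₗ e.symm.toLinearMap
  have hφ : ∀ x, φ (e x) = (R + LinearMap.id : V →ₗ[K] V) x := fun x =>
    congrArg (R + LinearMap.id : V →ₗ[K] V) (e.symm_apply_apply x)
  refine isSolvable_of_fixedPointFree φ (fun x y => ?_)
    ((LinearMap.ker_eq_bot.1 hker').comp e.symm.injective) ?_
  · obtain ⟨u, rfl⟩ := e.surjective x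
    obtain ⟨v, rfl⟩ := e.surjective y
    have h1 : ⁅e u, e v⁆ = e (indBr b R u v) := (hR.map_indBr h u v).symm
    rw [h1, hφ, hφ, hφ]
    exact hR.add_id_map_indBr h u v
  · have hsub : φ - (1 : Module.End K V) = e.symm.toLinearMap := by
      ext x
      obtain ⟨u, rfl⟩ := e.surjective x
      rw [LinearMap.sub_apply, hφ, LinearMap.add_apply, ← he, LinearMap.id_apply,
        Module.End.one_apply, add_sub_cancel_left]
      exact (e.symm_apply_apply u).symm
    rw [hsub]
    exact e.symm.injective

theorem rb_kernels (K : Type*) {V : Type*} [Field K] [CharZero K]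
    [AddCommGroup V] [Module K V] [FiniteDimensional K V]
    (nb : V → V → V) (hn : IsLieBr K nb)
    (R : V →ₗ[K] V) (hR : IsLieRB K nb R 1) :
    (¬ LieBrIso K (indBr nb R) nb →
      LinearMap.ker R ≠ ⊥ ∧ LinearMap.ker (R + LinearMap.id) ≠ ⊥) ∧
    ((¬ IsSolvableBr K (indBr nb R) ∨ ¬ IsSolvableBr K nb) →
      LinearMap.ker R ≠ ⊥ ∨ LinearMap.ker (R + LinearMap.id) ≠ ⊥) := by
  refine ⟨fun hiso => ⟨fun hker => ?_, fun hker => ?_⟩, fun hsol => ?_⟩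
  · exact hiso (lieBrIso_of_ker_eq_bot R hker (hR.map_indBr hn))
  · exact hiso (lieBrIso_of_ker_eq_bot _ hker (hR.add_id_map_indBr hn))
  · by_contra! hker
    have hs : IsSolvableBr K nb := hR.isSolvableBr hn hker.1 hker.2
    exact hsol.elim
      (fun hg => hg (hs.of_injective R (hR.map_indBr hn) (LinearMap.ker_eq_bot.1 hker.1)))
      (fun hg => hg hs)
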